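/- Let k be a field and let t ≤ min{p,q} be positive integers. Let X = (x_{ij}) be a p×q matrix of indeterminates, R = k[x_{ij}] the polynomial ring, and I = I_t(X) the ideal generated by the determinants of all t×t submatrices of X. Set h = (p−t+1)(q−t+1). Then the Demailly-like bound holds for I: for all integers n, m ≥ 1 one has (m+h−1) · α(I^{(n)}) ≥ n · (α(I^{(m)}) + h − 1), i.e., α(I^{(n)})/n ≥ (α(I^{(m)}) + h − 1)/(m+h−1). -/

import Mathlib

/-- The `n`-th symbolic power of an ideal `I`:
`f ∈ I^{(n)}` iff for every associated prime `P` of `R/I` there is `s ∉ P` with `s*f ∈ I^n`.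
(For a prime ideal `I` this is exactly `{f | ∃ s ∉ I, s*f ∈ I^n} = Iⁿ R_I ∩ R`.) -/
def symbolicPower {R : Type*} [CommRing R] (I : Ideal R) (n : ℕ) : Ideal R where
  carrier := {f | ∀ P ∈ associatedPrimes R (R ⧸ I), ∃ s, s ∉ P ∧ s * f ∈ I ^ n}
  zero_mem' := by
    intro P hP
    exact ⟨1, fun h => hP.1.ne_top ((Ideal.eq_top_iff_one P).mpr h), by simp⟩
  add_mem' := by
    intro a b ha hb P hP
    obtain ⟨s, hs, hsa⟩ := ha P hP
    obtain ⟨t, ht, htb⟩ := hb P hP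
    refine ⟨s * t, fun h => ((hP.1.mem_or_mem h).elim hs ht), ?_⟩
    have heq : s * t * (a + b) = t * (s * a) + s * (t * b) := by ring
    rw [heq]
    exact Ideal.add_mem _ (Ideal.mul_mem_left _ _ hsa) (Ideal.mul_mem_left _ _ htb)
  smul_mem' := by
    intro r a ha P hP
    obtain ⟨s, hs, hsa⟩ := ha P hP
    refine ⟨s, hs, ?_⟩
    have heq : s * (r • a) = r * (s * a) := by rw [smul_eq_mul]; ring
    rw [heq]
    exact Ideal.mul_mem_left _ _ hsa

/-- `α(J)`: the least degree of a nonzero homogeneous element of `J`. -/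
noncomputable def alphaDeg {k : Type*} [CommSemiring k] {σ : Type*}
    (J : Ideal (MvPolynomial σ k)) : ℕ :=
  sInf {d | ∃ f ∈ J, f ≠ 0 ∧ MvPolynomial.IsHomogeneous f d}

/-- The set of `t×t` minors of the generic `p×q` matrix `X = (x_{ij})` of indeterminates:
determinants of submatrices obtained by choosing `t` rows and `t` columns. -/
def genericMinors (k : Type*) [Field k] (p q t : ℕ) :
    Set (MvPolynomial (Fin p × Fin q) k) :=
  {f | ∃ (ri : Fin t → Fin p) (ci : Fin t → Fin q),
    Function.Injective ri ∧ Function.Injective ci ∧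
      f = Matrix.det (Matrix.of fun a b : Fin t => MvPolynomial.X (ri a, ci b))}

open Module in
theorem exists_linearIndependent_comp_of_le_finrank_span {K V ι : Type*} [Field K]
    [AddCommGroup V] [Module K V] [FiniteDimensional K V] (v : ι → V) (s : Set ι) {n : ℕ}
    (hn : n ≤ finrank K (Submodule.span K (v '' s))) :
    ∃ e : Fin n → ι, (∀ b, e b ∈ s) ∧ LinearIndependent K (v ∘ e) := by
  obtain ⟨f, hf, -, hli⟩ := Submodule.exists_fun_fin_finrank_span_eq K (v '' s)
  choose g hgs hg using hf
  refine ⟨fun b => g (Fin.castLE hn b), fun b => hgs _, ?_⟩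
  have : v ∘ (fun b => g (Fin.castLE hn b)) = f ∘ Fin.castLE hn := by
    funext b; exact hg _
  rw [this]
  exact hli.comp _ (Fin.castLE_injective hn)

open Module in
theorem det_submatrix_eq_zero_of_finrank_le {K m n : Type*} [Field K] [Fintype m]
    (M : Matrix m n K) (s : Set n) {r : ℕ}
    (hr : finrank K (Submodule.span K (M.col '' s)) ≤ r)
    (ri : Fin (r + 1) → m) (ci : Fin (r + 1) → n) (hci : ∀ b, ci b ∈ s) :
    (M.submatrix ri ci).det = 0 := by
  by_contra hdet
  have hli : LinearIndependent K (M.submatrix ri ci).col :=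
    Matrix.linearIndependent_cols_iff_isUnit.2
      ((Matrix.isUnit_iff_isUnit_det _).2 (isUnit_iff_ne_zero.2 hdet))
  have hli' : LinearIndependent K (fun b => M.col (ci b)) :=
    LinearIndependent.of_comp (LinearMap.funLeft K K ri) hli
  have h1 := finrank_span_eq_card hli'
  have h2 : Submodule.span K (Set.range fun b => M.col (ci b)) ≤
      Submodule.span K (M.col '' s) :=
    Submodule.span_mono (by rintro _ ⟨b, rfl⟩; exact ⟨_, hci b, rfl⟩)
  have h3 := Submodule.finrank_mono h2
  simp at h1
  omega

open Module in
theorem exists_det_submatrix_ne_zero {K m n : Type*} [Field K] [Fintype m]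
    (M : Matrix m n K) (s : Set n) {r : ℕ}
    (hr : r < finrank K (Submodule.span K (M.col '' s))) :
    ∃ (ri : Fin (r + 1) → m) (ci : Fin (r + 1) → n), (∀ b, ci b ∈ s) ∧
      (M.submatrix ri ci).det ≠ 0 := by
  classical
  obtain ⟨ci, hci, hli⟩ := exists_linearIndependent_comp_of_le_finrank_span M.col s hr
  set N : Matrix m (Fin (r + 1)) K := M.submatrix id ci with hN
  have hcol : LinearIndependent K N.col := hli
  have hrank : finrank K (Submodule.span K (N.row '' Set.univ)) = r + 1 := by
    rw [Set.image_univ, ← Matrix.rank_eq_finrank_span_row, Matrix.rank_eq_finrank_span_cols,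
      finrank_span_eq_card hcol, Fintype.card_fin]
  obtain ⟨ri, -, hli2⟩ := exists_linearIndependent_comp_of_le_finrank_span N.row Set.univ hrank.ge
  refine ⟨ri, ci, hci, ?_⟩
  have : LinearIndependent K (M.submatrix ri ci).row := hli2
  exact ((Matrix.isUnit_iff_isUnit_det _).1
    (Matrix.linearIndependent_rows_iff_isUnit.1 this)).ne_zero

/-- Evaluation of polynomials in the entries of a generic matrix at a given matrix. -/
noncomputable def matrixEval (k : Type*) {S m n : Type*} [CommSemiring k] [CommSemiring S]
    [Algebra k S] (M : Matrix m n S) : MvPolynomial (m × n) k →ₐ[k] S :=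
  MvPolynomial.aeval fun ij => M ij.1 ij.2

@[simp]
theorem matrixEval_X {k S m n : Type*} [CommSemiring k] [CommSemiring S] [Algebra k S]
    (M : Matrix m n S) (ij : m × n) : matrixEval k M (MvPolynomial.X ij) = M ij.1 ij.2 :=
  MvPolynomial.aeval_X _ _

theorem matrixEval_eq_zero_of_forall_add_smul {k K m n : Type*} [CommRing k] [Field K]
    [Infinite K] [Algebra k K] (M N : Matrix m n K) (f : MvPolynomial (m × n) k)
    (h : ∀ ε : K, ε ≠ 0 → matrixEval k (M + ε • N) f = 0) : matrixEval k M f = 0 := by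
  let L : Matrix m n (Polynomial K) :=
    Matrix.of fun i j => Polynomial.C (M i j) + Polynomial.X * Polynomial.C (N i j)
  have key : ∀ ε : K, (matrixEval k L f).eval ε = matrixEval k (M + ε • N) f := by
    intro ε
    have : ((Polynomial.aeval ε).restrictScalars k).comp (matrixEval k L) =
        matrixEval k (M + ε • N) := by
      ext ij
      simp [L, mul_comm ε]
    simpa [Polynomial.aeval_def, Polynomial.eval₂_eq_eval_map] using DFunLike.congr_fun this f
  have hz : matrixEval k L f = 0 := by
    refine Polynomial.eq_zero_of_infinite_isRoot _ (Set.Infinite.mono (s := {0}ᶜ) ?_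
      (Set.finite_singleton (0 : K)).infinite_compl)
    intro ε hε
    exact (key ε).trans (h ε hε)
  have := key 0
  rw [hz] at this
  simpa using this.symm

/-- The span of the first `j` columns of `M`. -/
def colSpan {K : Type*} [Field K] {p q : ℕ} (M : Matrix (Fin p) (Fin q) K) (j : ℕ) :
    Submodule K (Fin p → K) :=
  Submodule.span K (M.col '' {c | (c : ℕ) < j})

section RankLocus

variable {K : Type*} [Field K] {p q : ℕ}

theorem col_mem_colSpan (M : Matrix (Fin p) (Fin q) K) {c : Fin q} {j : ℕ} (h : (c : ℕ) < j) :
    M.col c ∈ colSpan M j :=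
  Submodule.subset_span ⟨c, h, rfl⟩

theorem colSpan_le_iff {M : Matrix (Fin p) (Fin q) K} {j : ℕ} {W : Submodule K (Fin p → K)} :
    colSpan M j ≤ W ↔ ∀ c : Fin q, (c : ℕ) < j → M.col c ∈ W := by
  rw [colSpan, Submodule.span_le]
  constructor
  · intro h c hc
    exact h ⟨c, hc, rfl⟩
  · rintro h _ ⟨c, hc, rfl⟩
    exact h c hc

/-- Matrices whose first `a` rows and first `n` entries of row `a` vanish, and whose first `j`
columns span a space of dimension at most `ρ j` for every `j`. -/
def rankLocus (K : Type*) [Field K] (p q a n : ℕ) (ρ : ℕ → ℕ) : Set (Matrix (Fin p) (Fin q) K) :=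
  {M | (∀ (i : Fin p) (j : Fin q), ((i : ℕ) < a ∨ ((i : ℕ) = a ∧ (j : ℕ) < n)) → M i j = 0) ∧
    ∀ j, Module.finrank K (colSpan M j) ≤ ρ j}

variable {k : Type*} [CommRing k] [Infinite K] [Algebra k K] {ρ : ℕ → ℕ}

theorem matrixEval_eq_zero_of_col_notMem {a : Fin p} {n : Fin q}
    {f : MvPolynomial (Fin p × Fin q) k}
    (hf : ∀ M ∈ rankLocus K p q a n ρ, M a n ≠ 0 → matrixEval k M f = 0)
    {M : Matrix (Fin p) (Fin q) K} (hM : M ∈ rankLocus K p q a n ρ)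
    (hn : M.col n ∉ colSpan M n) : matrixEval k M f = 0 := by
  by_cases h0 : M a n = 0
  swap
  · exact hf M hM h0
  obtain ⟨φ, hφn, hφ⟩ := Submodule.exists_le_ker_of_notMem hn
  refine matrixEval_eq_zero_of_forall_add_smul M
    (Matrix.of fun i j => if i = a then φ (M.col j) else 0) f fun ε hε => ?_
  have hφ0 : ∀ j : Fin q, (j : ℕ) < n → φ (M.col j) = 0 := fun j hj =>
    hφ (col_mem_colSpan M hj)
  refine hf _ ⟨?_, fun j => ?_⟩ ?_
  · rintro i j (hi | ⟨hi, hj⟩)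
    · have hia : i ≠ a := by rintro rfl; exact lt_irrefl _ hi
      simp [hia, hM.1 i j (Or.inl hi)]
    · simp [hφ0 j hj, hM.1 i j (Or.inr ⟨hi, hj⟩)]
  · refine le_trans ?_ (hM.2 j)
    let T : (Fin p → K) →ₗ[K] (Fin p → K) :=
      LinearMap.id + ε • (LinearMap.toSpanSingleton K (Fin p → K) (Pi.single a 1)).comp φ
    refine le_trans (Submodule.finrank_mono ?_) (Submodule.finrank_map_le T (colSpan M j))
    rw [colSpan_le_iff]
    intro c hc
    refine ⟨M.col c, col_mem_colSpan M hc, ?_⟩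
    ext i
    by_cases hi : i = a <;> simp [T, hi, Matrix.col]
  · simp [h0, hε, hφn]

theorem matrixEval_eq_zero_of_rankLocus {a : Fin p} {n : Fin q}
    {f : MvPolynomial (Fin p × Fin q) k} (hρ : Monotone ρ) (hlt : ρ n < ρ (n + 1))
    (hf : ∀ M ∈ rankLocus K p q a n ρ, M a n ≠ 0 → matrixEval k M f = 0)
    {M : Matrix (Fin p) (Fin q) K} (hM : M ∈ rankLocus K p q a n ρ) : matrixEval k M f = 0 := by
  by_cases hn : M.col n ∈ colSpan M n
  swap
  · exact matrixEval_eq_zero_of_col_notMem hf hM hn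
  obtain ⟨u, hu, hua, huj⟩ : ∃ u : Fin p → K, u ∉ colSpan M n ∧ (∀ i : Fin p, i < a → u i = 0) ∧
      ∀ j : ℕ, u ∈ colSpan M j ∨ colSpan M j ≤ colSpan M n := by
    by_cases hex : ∃ j : ℕ, ∃ hj : j < q, M.col ⟨j, hj⟩ ∉ colSpan M n
    · classical
      obtain ⟨hj, hj'⟩ := Nat.find_spec hex
      refine ⟨_, hj', fun i hi => hM.1 _ _ (Or.inl hi), fun j => ?_⟩
      rcases lt_or_ge (Nat.find hex) j with h | h
      · exact Or.inl (col_mem_colSpan M h)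
      · refine Or.inr (colSpan_le_iff.2 fun c hc => ?_)
        by_contra hcon
        exact Nat.find_min hex (lt_of_lt_of_le hc h) ⟨c.2, hcon⟩
    · push Not at hex
      refine ⟨Pi.single a 1, fun hmem => ?_, fun i hi => by simp [hi.ne],
        fun j => Or.inr (colSpan_le_iff.2 fun c _ => hex c c.2)⟩
      have : colSpan M n ≤ LinearMap.ker (LinearMap.proj a : (Fin p → K) →ₗ[K] K) :=
        colSpan_le_iff.2 fun c hc => hM.1 _ _ (Or.inr ⟨rfl, hc⟩)
      simpa using this hmem
  refine matrixEval_eq_zero_of_forall_add_smul M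
    (Matrix.of fun i j => if j = n then u i else 0) f fun ε hε => ?_
  set N : Matrix (Fin p) (Fin q) K := M + ε • Matrix.of fun i j => if j = n then u i else 0 with hN
  have hNc : ∀ c, c ≠ n → N.col c = M.col c := fun c hc => by
    ext i; simp [hN, hc, Matrix.col]
  have hNn : N.col n = M.col n + ε • u := by
    ext i; simp [hN, Matrix.col]
  have hle : ∀ j : ℕ, j ≤ n → colSpan N j = colSpan M j := by
    intro j hj
    unfold colSpan
    congr 1
    refine Set.image_congr fun c (hc : (c : ℕ) < j) => hNc c ?_
    rintro rfl
    omega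
  refine matrixEval_eq_zero_of_col_notMem hf (M := N) ⟨?_, fun j => ?_⟩ ?_
  · rintro i j (hi | ⟨hi, hj⟩)
    · simp [hN, hM.1 i j (Or.inl hi), hua i hi]
    · have : j ≠ n := by rintro rfl; exact lt_irrefl _ hj
      simp [hN, hM.1 i j (Or.inr ⟨hi, hj⟩), this]
  · rcases le_or_gt j n with hj | hj
    · rw [hle j hj]; exact hM.2 j
    · rcases huj j with hmem | hsub
      · refine le_trans (Submodule.finrank_mono (colSpan_le_iff.2 fun c hc => ?_)) (hM.2 j)
        by_cases hcn : c = n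
        · subst hcn
          rw [hNn]
          exact add_mem (col_mem_colSpan M hc) (Submodule.smul_mem _ _ hmem)
        · rw [hNc c hcn]; exact col_mem_colSpan M hc
      · have h1 : colSpan N j ≤ colSpan M n ⊔ Submodule.span K {u} := by
          refine colSpan_le_iff.2 fun c hc => ?_
          by_cases hcn : c = n
          · subst hcn
            rw [hNn]
            exact add_mem (Submodule.mem_sup_left hn) (Submodule.mem_sup_right
              (Submodule.smul_mem _ _ (Submodule.mem_span_singleton_self u)))
          · rw [hNc c hcn]
            exact Submodule.mem_sup_left (hsub (col_mem_colSpan M hc))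
        have h2 := Submodule.finrank_mono h1
        have h3 := Submodule.finrank_add_le_finrank_add_finrank (colSpan M n)
          (Submodule.span K {u})
        have h4 : Module.finrank K (Submodule.span K {u}) ≤ 1 := by
          simpa using finrank_span_le_card (R := K) {u}
        have h5 := hM.2 n
        have h6 := hρ (Nat.succ_le_of_lt hj)
        simp only [Nat.succ_eq_add_one] at h6
        omega
  · rw [hle n le_rfl, hNn]
    intro hmem
    exact hu ((Submodule.smul_mem_iff _ hε).1 ((Submodule.add_mem_iff_right _ hn).1 hmem))

end RankLocus

universe u

theorem mem_radical_of_forall_algHom {k : Type u} {σ : Type} [Field k]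
    {I : Ideal (MvPolynomial σ k)} {f : MvPolynomial σ k}
    (h : ∀ (K : Type u) [Field K] [Infinite K] [Algebra k K] (e : MvPolynomial σ k →ₐ[k] K),
      I ≤ RingHom.ker e → e f = 0) :
    f ∈ I.radical := by
  rw [Ideal.radical_eq_sInf, Submodule.mem_sInf]
  rintro P ⟨hIP, hP⟩
  let F := FractionRing (MvPolynomial σ k ⧸ P)
  let e : MvPolynomial σ k →ₐ[k] AlgebraicClosure F :=
    (IsScalarTower.toAlgHom k F (AlgebraicClosure F)).comp
      ((IsScalarTower.toAlgHom k (MvPolynomial σ k ⧸ P) F).comp (Ideal.Quotient.mkₐ k P))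
  have he : ∀ g, e g = 0 ↔ g ∈ P := fun g => by
    rw [← Ideal.Quotient.eq_zero_iff_mem,
      ← (IsFractionRing.injective (MvPolynomial σ k ⧸ P) F).eq_iff' (map_zero _)]
    exact map_eq_zero (algebraMap F (AlgebraicClosure F))
  exact (he f).1 (h (AlgebraicClosure F) e fun g hg => (he g).2 (hIP hg))

theorem matrixEval_of_apply_X {k S m n : Type*} [CommSemiring k] [CommSemiring S] [Algebra k S]
    (e : MvPolynomial (m × n) k →ₐ[k] S) :
    matrixEval k (Matrix.of fun i j => e (MvPolynomial.X (i, j))) = e := by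
  ext ij
  simp

section

attribute [local instance] MvPolynomial.gradedAlgebra

theorem isRadical_of_isRadical_sup_span {k σ : Type*} [Field k] {I : Ideal (MvPolynomial σ k)}
    (hI : I.IsHomogeneous (MvPolynomial.homogeneousSubmodule σ k)) {x : MvPolynomial σ k}
    (hx : x.IsHomogeneous 1) (hreg : ∀ y, x * y ∈ I.radical → y ∈ I.radical)
    (hrad : (I ⊔ Ideal.span {x}).IsRadical) : I.IsRadical := by
  have key : ∀ (d : ℕ), ∀ f ∈ I.radical, MvPolynomial.homogeneousComponent d f ∈ I := by
    intro d
    induction d with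
    | zero =>
      intro f hfr
      obtain ⟨i, hi, z, hz, rfl⟩ := Submodule.mem_sup.1 (hrad (Ideal.radical_mono le_sup_left hfr))
      obtain ⟨y, rfl⟩ := Ideal.mem_span_singleton.1 hz
      rw [map_add]
      refine add_mem ((MvPolynomial.mem_iff_homogeneousComponent_mem hI i).1 hi 0) ?_
      have : MvPolynomial.constantCoeff x = 0 := hx.coeff_eq_zero (by simp)
      simp [← MvPolynomial.constantCoeff_eq, this]
    | succ d ih =>
      intro f hfr
      obtain ⟨i, hi, z, hz, rfl⟩ := Submodule.mem_sup.1 (hrad (Ideal.radical_mono le_sup_left hfr))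
      obtain ⟨y, rfl⟩ := Ideal.mem_span_singleton.1 hz
      have hy : y ∈ I.radical :=
        hreg y ((Ideal.add_mem_iff_right _ (Ideal.le_radical hi)).1 hfr)
      rw [map_add]
      refine add_mem ((MvPolynomial.mem_iff_homogeneousComponent_mem hI i).1 hi _) ?_
      have := DirectSum.coe_decompose_mul_add_of_left_mem
        (MvPolynomial.homogeneousSubmodule σ k) (i := 1) (j := d) (b := y) hx
      rw [add_comm 1 d] at this
      have h2 : MvPolynomial.homogeneousComponent (d + 1) (x * y) =
          x * MvPolynomial.homogeneousComponent d y := by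
        rw [← MvPolynomial.decomposition.decompose'_apply,
          ← MvPolynomial.decomposition.decompose'_apply]
        exact this
      rw [h2]
      exact I.mul_mem_left _ (ih y hy)
  exact fun f hf => (MvPolynomial.mem_iff_homogeneousComponent_mem hI f).2 fun d => key d f hf

end

/-- The ideal cut out by the conditions defining `rankLocus`: it is generated by the entries of
the first `a` rows, the first `n` entries of row `a`, and the minors of size `ρ j + 1` of the first
`j` columns of the generic matrix, for all `j`. -/
noncomputable def rankIdeal (k : Type*) [CommRing k] (p q a n : ℕ) (ρ : ℕ → ℕ) :
    Ideal (MvPolynomial (Fin p × Fin q) k) :=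
  Ideal.span ({f | ∃ (i : Fin p) (j : Fin q), ((i : ℕ) < a ∨ ((i : ℕ) = a ∧ (j : ℕ) < n)) ∧
      f = MvPolynomial.X (i, j)} ∪
    {f | ∃ (j : ℕ) (ri : Fin (ρ j + 1) → Fin p) (ci : Fin (ρ j + 1) → Fin q),
      (∀ b, (ci b : ℕ) < j) ∧
        f = ((Matrix.mvPolynomialX (Fin p) (Fin q) k).submatrix ri ci).det})

theorem isHomogeneous_det_submatrix_mvPolynomialX {k m n : Type*} [CommRing k] {t : ℕ}
    (ri : Fin t → m) (ci : Fin t → n) :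
    ((Matrix.mvPolynomialX m n k).submatrix ri ci).det.IsHomogeneous t := by
  rw [Matrix.det_apply]
  refine MvPolynomial.IsHomogeneous.sum _ _ _ fun σ _ => ?_
  have : (∏ i, (Matrix.mvPolynomialX m n k).submatrix ri ci (σ i) i).IsHomogeneous t := by
    simpa using MvPolynomial.IsHomogeneous.prod Finset.univ
      (fun i => (Matrix.mvPolynomialX m n k).submatrix ri ci (σ i) i) (fun _ => 1)
      fun i _ => MvPolynomial.isHomogeneous_X _ _
  rcases Int.units_eq_one_or (Equiv.Perm.sign σ) with h | h
  · simpa [h] using this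
  · simpa [h] using this.neg

theorem det_submatrix_mem_of_le {R m n : Type*} [CommRing R] (M : Matrix m n R) (s : Set n)
    {J : Ideal R} {u v : ℕ} (huv : u ≤ v)
    (h : ∀ (ri : Fin u → m) (ci : Fin u → n), (∀ b, ci b ∈ s) → (M.submatrix ri ci).det ∈ J) :
    ∀ (ri : Fin v → m) (ci : Fin v → n), (∀ b, ci b ∈ s) → (M.submatrix ri ci).det ∈ J := by
  induction v, huv using Nat.le_induction with
  | base => exact h
  | succ v _ ih =>
    intro ri ci hci
    rw [Matrix.det_succ_row_zero]
    refine Ideal.sum_mem _ fun b _ => Ideal.mul_mem_left _ _ ?_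
    rw [Matrix.submatrix_submatrix]
    exact ih _ _ fun c => hci _

theorem map_det_submatrix_mvPolynomialX {k S m n : Type*} [CommRing k] [CommRing S] [Algebra k S]
    (e : MvPolynomial (m × n) k →ₐ[k] S) {t : ℕ} (ri : Fin t → m) (ci : Fin t → n) :
    e ((Matrix.mvPolynomialX m n k).submatrix ri ci).det =
      (Matrix.submatrix (Matrix.of fun i j => e (MvPolynomial.X (i, j))) ri ci).det := by
  rw [AlgHom.map_det]
  rfl

section RankIdeal

variable {k : Type*} [Field k] {p q a n : ℕ} {ρ : ℕ → ℕ}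

theorem X_mem_rankIdeal {i : Fin p} {j : Fin q}
    (h : (i : ℕ) < a ∨ ((i : ℕ) = a ∧ (j : ℕ) < n)) :
    (MvPolynomial.X (i, j) : MvPolynomial (Fin p × Fin q) k) ∈ rankIdeal k p q a n ρ :=
  Ideal.subset_span (Or.inl ⟨i, j, h, rfl⟩)

theorem det_mem_rankIdeal {j u : ℕ} (hu : u = ρ j + 1) (ri : Fin u → Fin p) (ci : Fin u → Fin q)
    (hci : ∀ b, (ci b : ℕ) < j) :
    ((Matrix.mvPolynomialX (Fin p) (Fin q) k).submatrix ri ci).det ∈ rankIdeal k p q a n ρ := by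
  subst hu
  exact Ideal.subset_span (Or.inr ⟨j, ri, ci, hci, rfl⟩)

theorem rankIdeal_le_iff {J : Ideal (MvPolynomial (Fin p × Fin q) k)} :
    rankIdeal k p q a n ρ ≤ J ↔
      (∀ (i : Fin p) (j : Fin q), ((i : ℕ) < a ∨ ((i : ℕ) = a ∧ (j : ℕ) < n)) →
        MvPolynomial.X (i, j) ∈ J) ∧
      ∀ (j : ℕ) (ri : Fin (ρ j + 1) → Fin p) (ci : Fin (ρ j + 1) → Fin q),
        (∀ b, (ci b : ℕ) < j) →
          ((Matrix.mvPolynomialX (Fin p) (Fin q) k).submatrix ri ci).det ∈ J := by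
  rw [rankIdeal, Ideal.span_le, Set.union_subset_iff]
  constructor
  · rintro ⟨h1, h2⟩
    exact ⟨fun i j h => h1 ⟨i, j, h, rfl⟩, fun j ri ci h => h2 ⟨j, ri, ci, h, rfl⟩⟩
  · rintro ⟨h1, h2⟩
    refine ⟨?_, ?_⟩
    · rintro _ ⟨i, j, h, rfl⟩
      exact h1 i j h
    · rintro _ ⟨j, ri, ci, h, rfl⟩
      exact h2 j ri ci h

theorem rankIdeal_le_ker_iff {K : Type*} [Field K] [Algebra k K]
    (e : MvPolynomial (Fin p × Fin q) k →ₐ[k] K) :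
    rankIdeal k p q a n ρ ≤ RingHom.ker e ↔
      (Matrix.of fun i j => e (MvPolynomial.X (i, j))) ∈ rankLocus K p q a n ρ := by
  rw [rankIdeal_le_iff]
  simp only [RingHom.mem_ker, map_det_submatrix_mvPolynomialX]
  refine and_congr Iff.rfl (forall_congr' fun j => ?_)
  constructor
  · intro h
    by_contra! hlt
    obtain ⟨ri, ci, hci, hne⟩ := exists_det_submatrix_ne_zero _ _ hlt
    exact hne (h ri ci hci)
  · intro h ri ci hci
    exact det_submatrix_eq_zero_of_finrank_le _ _ h ri ci hci

section

attribute [local instance] MvPolynomial.gradedAlgebra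

theorem isHomogeneous_rankIdeal : (rankIdeal k p q a n ρ).IsHomogeneous
    (MvPolynomial.homogeneousSubmodule (Fin p × Fin q) k) := by
  refine Ideal.homogeneous_span _ _ ?_
  rintro _ (⟨i, j, -, rfl⟩ | ⟨j, ri, ci, -, rfl⟩)
  · exact ⟨1, MvPolynomial.isHomogeneous_X _ _⟩
  · exact ⟨_, isHomogeneous_det_submatrix_mvPolynomialX ri ci⟩

end

theorem rankIdeal_sup_span_X (a : Fin p) (n : Fin q) :
    rankIdeal k p q a n ρ ⊔ Ideal.span {MvPolynomial.X (a, n)} = rankIdeal k p q a (n + 1) ρ := by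
  apply le_antisymm
  · refine sup_le (rankIdeal_le_iff.2 ⟨fun i j h => X_mem_rankIdeal ?_, fun j ri ci h =>
      det_mem_rankIdeal rfl ri ci h⟩) ?_
    · omega
    · rw [Ideal.span_singleton_le_iff_mem]
      exact X_mem_rankIdeal (Or.inr ⟨rfl, Nat.lt_succ_self _⟩)
  · refine rankIdeal_le_iff.2 ⟨fun i j h => ?_, fun j ri ci h =>
      Ideal.mem_sup_left (det_mem_rankIdeal rfl ri ci h)⟩
    by_cases hij : (i, j) = (a, n)
    · rw [hij]
      exact Ideal.mem_sup_right (Ideal.mem_span_singleton_self _)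
    · refine Ideal.mem_sup_left (X_mem_rankIdeal ?_)
      rw [Prod.mk.injEq, Fin.ext_iff, Fin.ext_iff] at hij
      omega

theorem mem_radical_rankIdeal_of_X_mul_mem {a : Fin p} {n : Fin q} (hρ : Monotone ρ)
    (hlt : ρ n < ρ (n + 1)) {y : MvPolynomial (Fin p × Fin q) k}
    (hy : MvPolynomial.X (a, n) * y ∈ (rankIdeal k p q a n ρ).radical) :
    y ∈ (rankIdeal k p q a n ρ).radical := by
  refine mem_radical_of_forall_algHom fun K _ _ _ e he => ?_
  have hM := (rankIdeal_le_ker_iff e).1 he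
  have : matrixEval k (Matrix.of fun i j => e (MvPolynomial.X (i, j))) y = 0 := by
    refine matrixEval_eq_zero_of_rankLocus hρ hlt (fun N hN hNan => ?_) hM
    have hN' : rankIdeal k p q a n ρ ≤ RingHom.ker (matrixEval k N) := by
      rw [rankIdeal_le_ker_iff]
      simpa only [matrixEval_X] using! hN
    have h3 := (RingHom.ker_isPrime (matrixEval k N)).isRadical.radical_le_iff.2 hN' hy
    rw [RingHom.mem_ker, map_mul, matrixEval_X] at h3
    exact (mul_eq_zero.1 h3).resolve_left hNan
  rwa [matrixEval_of_apply_X] at this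

theorem isRadical_rankIdeal_of_lt {a : Fin p} {n : Fin q} (hρ : Monotone ρ)
    (hlt : ρ n < ρ (n + 1)) (h : (rankIdeal k p q a (n + 1) ρ).IsRadical) :
    (rankIdeal k p q a n ρ).IsRadical := by
  refine isRadical_of_isRadical_sup_span isHomogeneous_rankIdeal
    (MvPolynomial.isHomogeneous_X k (a, n))
    (fun y hy => mem_radical_rankIdeal_of_X_mul_mem hρ hlt hy) ?_
  rwa [rankIdeal_sup_span_X]

/-- Expanding along a row whose entries in the remaining columns lie in the ideal. -/
theorem X_mul_det_mem_rankIdeal {a : Fin p} {n : Fin q} {s : ℕ} (hs : ρ (n + 1) = s)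
    (ri : Fin s → Fin p) (ci : Fin s → Fin q) (hci : ∀ b, (ci b : ℕ) < n) :
    MvPolynomial.X (a, n) * ((Matrix.mvPolynomialX (Fin p) (Fin q) k).submatrix ri ci).det ∈
      rankIdeal k p q a n ρ := by
  have h1 := det_mem_rankIdeal (k := k) (a := a) (n := n) (ρ := ρ) (j := n + 1) (u := s + 1)
    (by rw [hs]) (Fin.cons a ri) (Fin.cons n ci)
    (Fin.cases (by simp) fun b => by simpa using (hci b).trans (Nat.lt_succ_self _))
  rw [Matrix.det_succ_row_zero, Fin.sum_univ_succ] at h1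
  rw [Ideal.add_mem_iff_left] at h1
  · simpa [Matrix.submatrix_submatrix, Function.comp_def] using h1
  · refine Ideal.sum_mem _ fun b _ => Ideal.mul_mem_right _ _ (Ideal.mul_mem_left _ _ ?_)
    simpa using X_mem_rankIdeal (k := k) (ρ := ρ) (i := a) (j := ci b) (Or.inr ⟨rfl, hci b⟩)

theorem isRadical_rankIdeal_step {a : Fin p} {n : Fin q}
    (h : ∀ ρ : ℕ → ℕ, Monotone ρ → (rankIdeal k p q a (n + 1) ρ).IsRadical)
    (hρ : Monotone ρ) : (rankIdeal k p q a n ρ).IsRadical := by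
  rcases lt_or_ge (ρ n) (ρ (n + 1)) with hlt | hge
  · exact isRadical_rankIdeal_of_lt hρ hlt (h ρ hρ)
  rcases Nat.eq_zero_or_pos (ρ (n + 1)) with h0 | hpos
  · have hx : (MvPolynomial.X (a, n) : MvPolynomial (Fin p × Fin q) k) ∈
        rankIdeal k p q a n ρ := by
      simpa using X_mul_det_mem_rankIdeal (k := k) (a := a) h0 Fin.elim0 Fin.elim0
        (fun b => b.elim0)
    have h1 := h ρ hρ
    rwa [← rankIdeal_sup_span_X, sup_eq_left.2 ((Ideal.span_singleton_le_iff_mem _).2 hx)] at h1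
  set ρ' : ℕ → ℕ := fun j => if j ≤ n then min (ρ j) (ρ (n + 1) - 1) else ρ j with hρ'
  have hmono : Monotone ρ' := by
    intro i j hij
    have := hρ hij
    simp only [hρ']
    split_ifs <;> omega
  have hlt' : ρ' n < ρ' (n + 1) := by simp [hρ']; omega
  have hle : rankIdeal k p q a n ρ ≤ rankIdeal k p q a n ρ' := by
    refine rankIdeal_le_iff.2 ⟨fun i j hij => X_mem_rankIdeal hij, fun j ri ci hci => ?_⟩
    refine det_submatrix_mem_of_le _ {c : Fin q | (c : ℕ) < j} (u := ρ' j + 1) (v := ρ j + 1) ?_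
      (fun ri ci hci => det_mem_rankIdeal rfl ri ci hci) ri ci hci
    simp only [hρ']
    split_ifs <;> omega
  have hmul : ∀ f ∈ rankIdeal k p q a n ρ',
      MvPolynomial.X (a, n) * f ∈ rankIdeal k p q a n ρ := by
    have : rankIdeal k p q a n ρ' ≤
        (rankIdeal k p q a n ρ).colon {MvPolynomial.X (a, n)} := by
      rw [rankIdeal_le_iff]
      simp only [Submodule.mem_colon_singleton, smul_eq_mul]
      refine ⟨fun i j hij => Ideal.mul_mem_right _ _ (X_mem_rankIdeal hij), fun j ri ci hci => ?_⟩
      by_cases hj : j ≤ n ∧ ρ (n + 1) - 1 < ρ j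
      · rw [mul_comm]
        refine X_mul_det_mem_rankIdeal ?_ ri ci fun b => (hci b).trans_le hj.1
        simp only [hρ', if_pos hj.1]
        omega
      · refine Ideal.mul_mem_right _ _ (det_mem_rankIdeal (j := j) ?_ ri ci hci)
        simp only [hρ']
        split_ifs <;> omega
    intro f hf
    have := this hf
    rwa [Submodule.mem_colon_singleton, smul_eq_mul, mul_comm] at this
  have hrad' := isRadical_rankIdeal_of_lt hmono hlt' (h ρ' hmono)
  intro f hf
  have h1 := h ρ hρ
  rw [← rankIdeal_sup_span_X] at h1
  obtain ⟨i, hi, z, hz, rfl⟩ := Submodule.mem_sup.1 (h1 (Ideal.radical_mono le_sup_left hf))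
  obtain ⟨y, rfl⟩ := Ideal.mem_span_singleton.1 hz
  have hxy : MvPolynomial.X (a, n) * y ∈ (rankIdeal k p q a n ρ).radical :=
    (Ideal.add_mem_iff_right _ (Ideal.le_radical hi)).1 hf
  exact add_mem hi (hmul y (hrad' (mem_radical_rankIdeal_of_X_mul_mem hmono hlt'
    (Ideal.radical_mono hle hxy))))

end RankIdeal

section Determinantal

variable {k : Type*} [Field k] {p q : ℕ}

theorem isRadical_rankIdeal (a n : ℕ) {ρ : ℕ → ℕ} (hρ : Monotone ρ) (ha : a ≤ p) :
    (rankIdeal k p q a n ρ).IsRadical := by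
  induction ha using Nat.decreasingInduction generalizing n ρ with
  | self =>
    have : rankIdeal k p q p n ρ = RingHom.ker (matrixEval k (0 : Matrix (Fin p) (Fin q) k)) := by
      have hle : rankIdeal k p q p n ρ ≤
          RingHom.ker (matrixEval k (0 : Matrix (Fin p) (Fin q) k)) := by
        rw [rankIdeal_le_ker_iff]
        refine ⟨fun i j _ => by simp, fun j => ?_⟩
        have : colSpan (Matrix.of fun i j => matrixEval k (0 : Matrix (Fin p) (Fin q) k)
            (MvPolynomial.X (i, j))) j = ⊥ := by
          refine le_bot_iff.1 (colSpan_le_iff.2 fun c _ => ?_)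
          rw [Submodule.mem_bot]
          ext i
          simp [Matrix.col]
        exact this ▸ (finrank_bot k _).trans_le (Nat.zero_le _)
      refine le_antisymm hle fun f hf => ?_
      have key : ∀ g : MvPolynomial (Fin p × Fin q) k,
          g - MvPolynomial.C (MvPolynomial.constantCoeff g) ∈ rankIdeal k p q p n ρ := by
        intro g
        induction g using MvPolynomial.induction_on with
        | C c => simp
        | add f g hf hg =>
          rw [map_add, map_add, add_sub_add_comm]
          exact add_mem hf hg
        | mul_X f i hf =>
          simpa using Ideal.mul_mem_left _ f (X_mem_rankIdeal (Or.inl i.1.2))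
      have h0 : MvPolynomial.constantCoeff f = 0 := by
        have h1 : matrixEval k (0 : Matrix (Fin p) (Fin q) k) f = 0 := hf
        rw [matrixEval] at h1
        simpa [MvPolynomial.aeval_zero'] using h1
      simpa [h0] using key f
    rw [this]
    exact (RingHom.ker_isPrime _).isRadical
  | of_succ a ha ih =>
    have hq : ∀ ρ : ℕ → ℕ, Monotone ρ → ∀ n, q ≤ n → (rankIdeal k p q a n ρ).IsRadical := by
      intro ρ hρ n hn
      have : rankIdeal k p q a n ρ = rankIdeal k p q (a + 1) 0 ρ := by
        unfold rankIdeal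
        congr 2
        ext f
        simp only [Set.mem_ofPred_eq]
        refine exists_congr fun i => exists_congr fun j => and_congr_left fun _ => ?_
        have := j.2
        omega
      rw [this]
      exact ih 0 hρ
    rcases le_or_gt q n with hn | hn
    · exact hq ρ hρ n hn
    · have hn' := hn.le
      clear hn
      induction hn' using Nat.decreasingInduction generalizing ρ with
      | self => exact hq ρ hρ q le_rfl
      | of_succ n hn' ihn =>
        refine isRadical_rankIdeal_step (a := ⟨a, ha⟩) (n := ⟨n, hn'⟩) (fun ρ' hρ' => ihn hρ') hρ

theorem span_genericMinors_eq_rankIdeal (s : ℕ) :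
    Ideal.span (genericMinors k p q (s + 1)) = rankIdeal k p q 0 0 fun _ => s := by
  apply le_antisymm
  · rw [Ideal.span_le]
    rintro _ ⟨ri, ci, -, -, rfl⟩
    have h := det_mem_rankIdeal (k := k) (a := 0) (n := 0) (ρ := fun _ => s) (j := q) rfl ri ci
      fun b => (ci b).2
    exact h
  · refine rankIdeal_le_iff.2 ⟨fun i j h => by omega, fun j ri ci _ => ?_⟩
    by_cases hri : Function.Injective ri
    · by_cases hci : Function.Injective ci
      · exact Ideal.subset_span ⟨ri, ci, hri, hci, rfl⟩
      · obtain ⟨b, c, hbc, hne⟩ := Function.not_injective_iff.1 hci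
        have h : ((Matrix.mvPolynomialX (Fin p) (Fin q) k).submatrix ri ci).det = 0 :=
          Matrix.det_zero_of_column_eq hne fun i => by simp [hbc]
        rw [h]
        exact zero_mem _
    · obtain ⟨b, c, hbc, hne⟩ := Function.not_injective_iff.1 hri
      have h : ((Matrix.mvPolynomialX (Fin p) (Fin q) k).submatrix ri ci).det = 0 :=
        Matrix.det_zero_of_row_eq hne (by ext i; simp [hbc])
      rw [h]
      exact zero_mem _

/-- The product of generic matrices of sizes `p × s` and `s × q`. -/
noncomputable def genericProduct (k : Type*) [Field k] (p q s : ℕ) :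
    Matrix (Fin p) (Fin q) (MvPolynomial ((Fin p × Fin s) ⊕ (Fin s × Fin q)) k) :=
  (Matrix.of fun i l => MvPolynomial.X (Sum.inl (i, l))) *
    (Matrix.of fun l j => MvPolynomial.X (Sum.inr (l, j)))

theorem genericProduct_apply {s : ℕ} (i : Fin p) (j : Fin q) : genericProduct k p q s i j =
    ∑ l, MvPolynomial.X (Sum.inl (i, l)) * MvPolynomial.X (Sum.inr (l, j)) := rfl

theorem exists_mul_eq_of_finrank_le {K : Type*} [Field K] {s : ℕ} (M : Matrix (Fin p) (Fin q) K)
    (h : Module.finrank K (Submodule.span K (Set.range M.col)) ≤ s) :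
    ∃ (A : Matrix (Fin p) (Fin s) K) (B : Matrix (Fin s) (Fin q) K), A * B = M := by
  obtain ⟨f, -, hspan, -⟩ := Submodule.exists_fun_fin_finrank_span_eq K (Set.range M.col)
  let g : Fin s → (Fin p → K) := fun l => if h : (l : ℕ) < _ then f ⟨l, h⟩ else 0
  have hle : Submodule.span K (Set.range M.col) ≤ Submodule.span K (Set.range g) := by
    rw [← hspan]
    refine Submodule.span_mono ?_
    rintro _ ⟨b, rfl⟩
    exact ⟨Fin.castLE h b, by simp [g]⟩
  have hB : ∀ j, ∃ c : Fin s → K, ∑ l, c l • g l = M.col j := fun j =>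
    (Submodule.mem_span_range_iff_exists_fun K).1 (hle (Submodule.subset_span ⟨j, rfl⟩))
  choose B hB using hB
  refine ⟨Matrix.of fun i l => g l i, Matrix.of fun l j => B j l, ?_⟩
  ext i j
  have := congrFun (hB j) i
  simp only [Finset.sum_apply, Pi.smul_apply, smul_eq_mul, Matrix.col_apply] at this
  rw [← this, Matrix.mul_apply]
  exact Finset.sum_congr rfl fun l _ => mul_comm _ _

theorem rankIdeal_zero_eq_ker (s : ℕ) :
    rankIdeal k p q 0 0 (fun _ => s) = RingHom.ker (matrixEval k (genericProduct k p q s)) := by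
  apply le_antisymm
  · let F := FractionRing (MvPolynomial ((Fin p × Fin s) ⊕ (Fin s × Fin q)) k)
    let ι : MvPolynomial ((Fin p × Fin s) ⊕ (Fin s × Fin q)) k →ₐ[k] F :=
      IsScalarTower.toAlgHom k _ F
    have hι : Function.Injective ι := IsFractionRing.injective _ F
    have hker : rankIdeal k p q 0 0 (fun _ => s) ≤
        RingHom.ker (ι.comp (matrixEval k (genericProduct k p q s))) := by
      rw [rankIdeal_le_ker_iff]
      refine ⟨fun i j h => by omega, fun j => ?_⟩
      set A : Matrix (Fin p) (Fin s) F := Matrix.of fun i l => ι (MvPolynomial.X (Sum.inl (i, l)))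
      have hsub : colSpan (Matrix.of fun i j => (ι.comp (matrixEval k (genericProduct k p q s)))
          (MvPolynomial.X (i, j))) j ≤ LinearMap.range A.mulVecLin := by
        refine colSpan_le_iff.2 fun c _ =>
          ⟨fun l => ι (MvPolynomial.X (Sum.inr (l, c))), ?_⟩
        ext i
        simp [A, Matrix.mulVec, dotProduct, genericProduct_apply, Matrix.col]
      exact (Submodule.finrank_mono hsub).trans
        ((LinearMap.finrank_range_le _).trans (by simp))
    intro f hf
    exact hι ((hker hf).trans (map_zero ι).symm)
  · intro f hf
    refine isRadical_rankIdeal 0 0 monotone_const (Nat.zero_le p)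
      (mem_radical_of_forall_algHom fun K _ _ _ e he => ?_)
    obtain ⟨A, B, hAB⟩ := exists_mul_eq_of_finrank_le (s := s)
      (Matrix.of fun i j => e (MvPolynomial.X (i, j))) (by
        refine le_trans (Submodule.finrank_mono (Submodule.span_le.2 ?_))
          (((rankIdeal_le_ker_iff e).1 he).2 q)
        rintro _ ⟨c, rfl⟩
        exact col_mem_colSpan _ c.2)
    let τ : MvPolynomial ((Fin p × Fin s) ⊕ (Fin s × Fin q)) k →ₐ[k] K :=
      MvPolynomial.aeval (Sum.elim (fun x => A x.1 x.2) fun x => B x.1 x.2)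
    have hτ : τ.comp (matrixEval k (genericProduct k p q s)) = e := by
      ext ⟨i, j⟩
      have := congrFun (congrFun hAB i) j
      rw [Matrix.mul_apply, Matrix.of_apply] at this
      simp [τ, genericProduct_apply, this]
    rw [← hτ, AlgHom.comp_apply, (RingHom.mem_ker).1 hf, map_zero]

end Determinantal

theorem mem_symbolicPower_iff {R : Type*} [CommRing R] [IsNoetherianRing R] {I : Ideal R}
    [hI : I.IsPrime] {n : ℕ} {f : R} : f ∈ symbolicPower I n ↔ ∃ s ∉ I, s * f ∈ I ^ n := by
  change (∀ P ∈ associatedPrimes R (R ⧸ I), ∃ s, s ∉ P ∧ s * f ∈ I ^ n) ↔ _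
  rw [associatedPrimes.eq_singleton_of_isPrimary hI.isPrimary, hI.radical]
  simp

section LowerBound

variable {k : Type*} [Field k] {p q : ℕ}

theorem span_genericMinors_eq_ker (k : Type*) [Field k] (p q s : ℕ) :
    Ideal.span (genericMinors k p q (s + 1)) =
      RingHom.ker (matrixEval k (genericProduct k p q s)) := by
  rw [span_genericMinors_eq_rankIdeal, rankIdeal_zero_eq_ker]

theorem isPrime_span_genericMinors (k : Type*) [Field k] (p q s : ℕ) :
    (Ideal.span (genericMinors k p q (s + 1))).IsPrime := by
  rw [span_genericMinors_eq_ker]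
  exact RingHom.ker_isPrime _

/-- The substitution `X_v ↦ T ^ w v * X_v`, with values in polynomials in `T`. -/
noncomputable def weightScale (k : Type*) [CommSemiring k] {σ : Type*} (w : σ → ℕ) :
    MvPolynomial σ k →ₐ[k] Polynomial (MvPolynomial σ k) :=
  MvPolynomial.aeval fun v => Polynomial.X ^ w v * Polynomial.C (MvPolynomial.X v)

theorem weightScale_monomial {σ : Type*} (w : σ → ℕ) (m : σ →₀ ℕ) (c : k) :
    weightScale k w (MvPolynomial.monomial m c) =
      Polynomial.monomial (Finsupp.weight w m) (MvPolynomial.monomial m c) := by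
  rw [weightScale, MvPolynomial.aeval_monomial, Finsupp.weight_apply]
  simp only [mul_pow, Finsupp.prod_mul, ← pow_mul]
  rw [Finsupp.prod, Finsupp.prod, Finset.prod_pow_eq_pow_sum, ← Polynomial.C_mul_X_pow_eq_monomial,
    MvPolynomial.monomial_eq, Finsupp.prod, Finsupp.sum, Polynomial.algebraMap_apply,
    MvPolynomial.algebraMap_eq]
  simp only [map_mul, map_prod, map_pow, smul_eq_mul]
  rw [mul_comm (Polynomial.X ^ _), mul_assoc]
  simp only [mul_comm]

theorem coeff_coeff_weightScale {σ : Type*} (w : σ → ℕ) (F : MvPolynomial σ k) (m : σ →₀ ℕ) :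
    MvPolynomial.coeff m ((weightScale k w F).coeff (Finsupp.weight w m)) =
      MvPolynomial.coeff m F := by
  classical
  conv_lhs => rw [F.as_sum, map_sum]
  simp only [weightScale_monomial, Polynomial.finsetSum_coeff, MvPolynomial.coeff_sum,
    Polynomial.coeff_monomial]
  rw [Finset.sum_eq_single m]
  · simp
  · intro b _ hb
    split_ifs
    · rw [MvPolynomial.coeff_monomial, if_neg hb]
    · simp
  · intro hm
    simpa using hm

theorem aeval_mul_of_isHomogeneous {σ S : Type*} [CommSemiring S] [Algebra k S]
    {f : MvPolynomial σ k} {d : ℕ} (hf : f.IsHomogeneous d) (x : S) (g : σ → S) :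
    MvPolynomial.aeval (fun i => x * g i) f = x ^ d * MvPolynomial.aeval g f := by
  conv_lhs => rw [f.as_sum, map_sum]
  conv_rhs => rw [f.as_sum, map_sum]
  rw [Finset.mul_sum]
  refine Finset.sum_congr rfl fun m hm => ?_
  have hd : ∑ i ∈ m.support, m i = d := by
    have := hf (MvPolynomial.mem_support_iff.1 hm)
    simpa [Finsupp.weight_apply, Finsupp.sum] using this
  rw [MvPolynomial.aeval_monomial, MvPolynomial.aeval_monomial, Finsupp.prod, Finsupp.prod]
  simp only [mul_pow]
  rw [Finset.prod_mul_distrib, Finset.prod_pow_eq_pow_sum, hd]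
  ring

/-- Scaling the rows of the second factor of `genericProduct k p q p` by powers of `T`. -/
noncomputable def rowScale (k : Type*) [Field k] (p q : ℕ) (u : Fin p → ℕ) :
    MvPolynomial (Fin p × Fin q) k →ₐ[k]
      Polynomial (MvPolynomial ((Fin p × Fin p) ⊕ (Fin p × Fin q)) k) :=
  (weightScale k (Sum.elim (fun _ => 0) fun x => u x.1)).comp
    (matrixEval k (genericProduct k p q p))

theorem rowScale_X (u : Fin p → ℕ) (i : Fin p) (j : Fin q) :
    rowScale k p q u (MvPolynomial.X (i, j)) =
      ∑ l, Polynomial.X ^ u l * Polynomial.C (MvPolynomial.X (Sum.inl (i, l)) *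
        MvPolynomial.X (Sum.inr (l, j))) := by
  simp only [rowScale, AlgHom.comp_apply, matrixEval_X, genericProduct_apply, map_sum, map_mul,
    weightScale, MvPolynomial.aeval_X, Sum.elim_inl, Sum.elim_inr, pow_zero, one_mul]
  refine Finset.sum_congr rfl fun l _ => ?_
  ring

theorem rowScale_one {f : MvPolynomial (Fin p × Fin q) k} {d : ℕ} (hf : f.IsHomogeneous d) :
    rowScale k p q (fun _ => 1) f =
      Polynomial.X ^ d * Polynomial.C (matrixEval k (genericProduct k p q p) f) := by
  have h : rowScale k p q (fun _ => 1) = MvPolynomial.aeval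
      (fun x => Polynomial.X * Polynomial.C (genericProduct k p q p x.1 x.2)) := by
    ext1 ⟨i, j⟩
    rw [rowScale_X, MvPolynomial.aeval_X, genericProduct_apply, map_sum, Finset.mul_sum]
    simp
  have h2 : MvPolynomial.aeval (fun x : Fin p × Fin q =>
      Polynomial.C (genericProduct k p q p x.1 x.2)) =
      ((Polynomial.CAlgHom (R := MvPolynomial ((Fin p × Fin p) ⊕ (Fin p × Fin q)) k)
        (A := MvPolynomial ((Fin p × Fin p) ⊕ (Fin p × Fin q)) k)).restrictScalars k).comp (matrixEval k (genericProduct k p q p)) := by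
    ext1 ⟨i, j⟩
    simp
  rw [h, aeval_mul_of_isHomogeneous hf, h2]
  rfl

theorem rowScale_coeff_zero {s : ℕ} {e : Fin s → Fin p} (he : Function.Injective e)
    {u : Fin p → ℕ} (hu : ∀ l, u l = 0 ↔ l ∈ Set.range e) (f : MvPolynomial (Fin p × Fin q) k) :
    (rowScale k p q u f).coeff 0 =
      MvPolynomial.rename (Sum.map (fun x => (x.1, e x.2)) fun x => (e x.1, x.2))
        (matrixEval k (genericProduct k p q s) f) := by
  have h : ((Polynomial.aeval 0).restrictScalars k).comp (rowScale k p q u) =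
      (MvPolynomial.rename (Sum.map (fun x : Fin p × Fin s => (x.1, e x.2))
        fun x : Fin s × Fin q => (e x.1, x.2))).comp (matrixEval k (genericProduct k p q s)) := by
    ext1 ⟨i, j⟩
    simp only [AlgHom.comp_apply, rowScale_X, matrixEval_X, genericProduct_apply, map_sum,
      map_mul, MvPolynomial.rename_X, AlgHom.restrictScalars_apply, map_pow, Polynomial.aeval_X,
      Polynomial.aeval_C, Sum.map_inl, Sum.map_inr]
    symm
    refine Finset.sum_of_injOn e he.injOn (by simp) (fun l _ hl => ?_) fun l _ => ?_
    · have : u l ≠ 0 := fun h0 => hl (by simpa using (hu l).1 h0)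
      simp [this]
    · simp [(hu (e l)).2 ⟨l, rfl⟩]
  have := DFunLike.congr_fun h f
  simpa [Polynomial.coeff_zero_eq_aeval_zero] using this

theorem X_pow_dvd_rowScale {s n : ℕ} {e : Fin s → Fin p} (he : Function.Injective e)
    {u : Fin p → ℕ} (hu : ∀ l, u l = 0 ↔ l ∈ Set.range e) {f : MvPolynomial (Fin p × Fin q) k}
    (hf : f ∈ symbolicPower (Ideal.span (genericMinors k p q (s + 1))) n) :
    Polynomial.X ^ n ∣ rowScale k p q u f := by
  have hI := isPrime_span_genericMinors k p q s
  obtain ⟨c, hc, hcf⟩ := mem_symbolicPower_iff.1 hf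
  have hdvd : ∀ g, Polynomial.X ∣ rowScale k p q u g ↔
      g ∈ Ideal.span (genericMinors k p q (s + 1)) := fun g => by
    rw [Polynomial.X_dvd_iff, rowScale_coeff_zero he hu, span_genericMinors_eq_ker,
      RingHom.mem_ker]
    refine map_eq_zero_iff _ (MvPolynomial.rename_injective _ (Sum.map_injective.2 ⟨?_, ?_⟩))
    · rintro ⟨i, l⟩ ⟨i', l'⟩ h
      simpa [he.eq_iff] using h
    · rintro ⟨i, l⟩ ⟨i', l'⟩ h
      simpa [he.eq_iff] using h
  have hle : Ideal.span (genericMinors k p q (s + 1)) ^ n ≤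
      (Ideal.span {Polynomial.X ^ n}).comap (rowScale k p q u) := by
    rw [← Ideal.span_singleton_pow]
    refine le_trans (Ideal.pow_right_mono (fun g hg => ?_) n) (Ideal.le_comap_pow _ _)
    exact Ideal.mem_span_singleton.2 ((hdvd g).2 hg)
  have h1 := Ideal.mem_span_singleton.1 (hle hcf)
  rw [map_mul] at h1
  exact Polynomial.prime_X.pow_dvd_of_dvd_mul_left n (fun h => hc ((hdvd c).1 h)) h1

theorem matrixEval_genericProduct_ne_zero {f : MvPolynomial (Fin p × Fin q) k} (hf : f ≠ 0) :
    matrixEval k (genericProduct k p q p) f ≠ 0 := by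
  let τ : MvPolynomial ((Fin p × Fin p) ⊕ (Fin p × Fin q)) k →ₐ[k]
      MvPolynomial (Fin p × Fin q) k :=
    MvPolynomial.aeval (Sum.elim (fun x => (1 : Matrix (Fin p) (Fin p) _) x.1 x.2) MvPolynomial.X)
  have h : τ.comp (matrixEval k (genericProduct k p q p)) = AlgHom.id k _ := by
    ext1 ⟨i, j⟩
    simp [τ, genericProduct_apply, Matrix.one_apply]
  intro h0
  apply hf
  rw [← AlgHom.id_apply (R := k) f, ← h, AlgHom.comp_apply, h0, map_zero]

theorem weight_sumElim_zero (u : Fin p → ℕ) (m : (Fin p × Fin p) ⊕ (Fin p × Fin q) →₀ ℕ) :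
    Finsupp.weight (Sum.elim (fun _ => 0) fun x => u x.1) m =
      ∑ i, u i * ∑ j, m (Sum.inr (i, j)) := by
  rw [Finsupp.weight_apply, Finsupp.sum_fintype _ _ (by simp), Fintype.sum_sum_type]
  simp [Fintype.sum_prod_type, Finset.mul_sum, mul_comm]

/-- A nonzero form in the symbolic power `I_{s+1}^{(n)}` of a `p × q` matrix has degree at
least `p * n / (p - s)`. -/
theorem mul_add_mul_le_of_mem_symbolicPower {s n d : ℕ} (hs : s < p)
    {f : MvPolynomial (Fin p × Fin q) k}
    (hf : f ∈ symbolicPower (Ideal.span (genericMinors k p q (s + 1))) n) (hf0 : f ≠ 0)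
    (hfd : f.IsHomogeneous d) : p * n + s * d ≤ p * d := by
  have : NeZero p := ⟨by omega⟩
  set F := matrixEval k (genericProduct k p q p) f with hF
  obtain ⟨m, hm⟩ := Finset.nonempty_iff_ne_empty.2
    (mt MvPolynomial.support_eq_empty.1 (matrixEval_genericProduct_ne_zero hf0))
  rw [MvPolynomial.mem_support_iff, ← hF] at hm
  set r : Fin p → ℕ := fun i => ∑ j, m (Sum.inr (i, j)) with hr
  have hd : ∑ i, r i = d := by
    by_contra hne
    apply hm
    rw [← coeff_coeff_weightScale (Sum.elim (fun _ => 0) fun x => 1) F m]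
    have h1 := rowScale_one hfd
    rw [rowScale, AlgHom.comp_apply] at h1
    rw [h1, Polynomial.coeff_X_pow_mul', Polynomial.coeff_C]
    have h2 : Finsupp.weight (Sum.elim (fun _ => 0) fun _ => 1) m = ∑ i, r i := by
      simpa using weight_sumElim_zero (fun _ => 1) m
    rw [h2]
    split_ifs
    · omega
    · simp
    · simp
  have hle : ∀ c : Fin p, n + ∑ l : Fin s, r (c + Fin.castLE hs.le l) ≤ d := by
    intro c
    classical
    have he : Function.Injective fun l : Fin s => c + Fin.castLE hs.le l :=
      (add_right_injective c).comp (Fin.castLE_injective _)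
    set e := fun l : Fin s => c + Fin.castLE hs.le l with he'
    set u : Fin p → ℕ := fun i => if i ∈ Set.range e then 0 else 1 with hu
    have hu0 : ∀ i ∈ Set.range e, u i = 0 := fun i hi => if_pos hi
    have hu1 : ∀ i ∉ Set.range e, u i = 1 := fun i hi => if_neg hi
    have h1 : Polynomial.X ^ n ∣ rowScale k p q u f :=
      X_pow_dvd_rowScale he (fun l => by simp [hu]) hf
    have h2 : n ≤ ∑ i, u i * r i := by
      rw [← weight_sumElim_zero]
      by_contra! hlt
      apply hm
      rw [← coeff_coeff_weightScale (Sum.elim (fun _ => 0) fun x => u x.1) F m]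
      rw [rowScale, AlgHom.comp_apply] at h1
      rw [Polynomial.X_pow_dvd_iff.1 h1 _ hlt, MvPolynomial.coeff_zero]
    have h3 : ∑ l : Fin s, r (e l) = ∑ i, (1 - u i) * r i := by
      refine Finset.sum_of_injOn e he.injOn (by simp) (fun l _ hl => ?_) fun l _ => ?_
      · have : l ∉ Set.range e := by simpa using hl
        simp [hu1 l this]
      · simp [hu0 (e l) ⟨l, rfl⟩]
    rw [h3, ← hd]
    refine (Nat.add_le_add_right h2 _).trans ?_
    rw [← Finset.sum_add_distrib]
    refine Finset.sum_le_sum fun i _ => ?_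
    by_cases hi : i ∈ Set.range e
    · simp [hu0 i hi]
    · simp [hu1 i hi]
  have hsum := Finset.sum_le_sum fun c (_ : c ∈ Finset.univ) => hle c
  rw [Finset.sum_add_distrib, Finset.sum_comm] at hsum
  have hshift : ∀ l : Fin s, ∑ c, r (c + Fin.castLE hs.le l) = d := fun l => by
    rw [← hd]
    exact Equiv.sum_comp (Equiv.addRight (Fin.castLE hs.le l)) r
  simpa [hshift] using hsum

end LowerBound

theorem mul_mem_symbolicPower {R : Type*} [CommRing R] {I : Ideal R} {m n : ℕ} {f g : R}
    (hf : f ∈ symbolicPower I m) (hg : g ∈ symbolicPower I n) :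
    f * g ∈ symbolicPower I (m + n) := by
  intro P hP
  obtain ⟨s, hs, hsf⟩ := hf P hP
  obtain ⟨t, ht, htg⟩ := hg P hP
  refine ⟨s * t, fun h => (hP.1.mem_or_mem h).elim hs ht, ?_⟩
  rw [mul_mul_mul_comm, pow_add]
  exact Ideal.mul_mem_mul hsf htg

theorem pow_mem_symbolicPower {R : Type*} [CommRing R] {I : Ideal R} {m : ℕ} {f : R}
    (hf : f ∈ symbolicPower I m) (a : ℕ) : f ^ a ∈ symbolicPower I (m * a) := by
  induction a with
  | zero =>
    intro P hP
    exact ⟨1, (Ideal.ne_top_iff_one P).1 hP.1.ne_top, by simp⟩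
  | succ a ih =>
    rw [pow_succ, Nat.mul_succ]
    exact mul_mem_symbolicPower ih hf

theorem det_pow_card_mul_det_fromBlocks {R l n : Type*} [CommRing R] [Fintype l] [DecidableEq l]
    [Fintype n] [DecidableEq n] (A : Matrix l l R) (B : Matrix l n R) (C : Matrix n l R)
    (D : Matrix n n R) : A.det ^ Fintype.card n * (Matrix.fromBlocks A B C D).det =
      A.det * (A.det • D - C * A.adjugate * B).det := by
  have h : Matrix.fromBlocks 1 0 (-(C * A.adjugate)) (A.det • (1 : Matrix n n R)) *
      Matrix.fromBlocks A B C D = Matrix.fromBlocks A B 0 (A.det • D - C * A.adjugate * B) := by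
    rw [Matrix.fromBlocks_multiply]
    congr 1
    · simp
    · simp
    · simp [Matrix.mul_assoc, Matrix.adjugate_mul]
    · simp [sub_eq_neg_add]
  have h2 := congrArg Matrix.det h
  rwa [Matrix.det_mul, Matrix.det_fromBlocks_zero₁₂, Matrix.det_fromBlocks_zero₂₁, Matrix.det_one,
    one_mul, Matrix.det_smul, Matrix.det_one, mul_one] at h2

theorem det_mem_pow_card {R n : Type*} [CommRing R] [Fintype n] [DecidableEq n] {I : Ideal R}
    {E : Matrix n n R} (h : ∀ i j, E i j ∈ I) : E.det ∈ I ^ Fintype.card n := by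
  rw [Matrix.det_apply]
  refine Ideal.sum_mem _ fun σ _ => ?_
  have : ∏ i, E (σ i) i ∈ I ^ Fintype.card n := by
    simpa using Ideal.prod_mem_prod (s := Finset.univ) (I := fun _ => I)
      fun i (_ : i ∈ Finset.univ) => h (σ i) i
  rw [Units.smul_def, zsmul_eq_mul]
  exact Ideal.mul_mem_left _ _ this

section UpperBound

variable {k : Type*} [Field k] {p q : ℕ}

theorem det_submatrix_notMem_ker {s : ℕ} {ri : Fin s → Fin p} {ci : Fin s → Fin q}
    (hri : Function.Injective ri) (hci : Function.Injective ci) :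
    ((Matrix.mvPolynomialX (Fin p) (Fin q) k).submatrix ri ci).det ∉
      RingHom.ker (matrixEval k (genericProduct k p q s)) := by
  intro h
  let τ : MvPolynomial ((Fin p × Fin s) ⊕ (Fin s × Fin q)) k →ₐ[k] k :=
    MvPolynomial.aeval (Sum.elim (fun x => if x.1 = ri x.2 then 1 else 0)
      fun x => if x.2 = ci x.1 then 1 else 0)
  have h1 := congrArg τ ((RingHom.mem_ker).1 h)
  rw [map_zero, ← AlgHom.comp_apply, map_det_submatrix_mvPolynomialX] at h1
  have h2 : (Matrix.submatrix (Matrix.of fun i j => (τ.comp (matrixEval k (genericProduct k p q s)))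
      (MvPolynomial.X (i, j))) ri ci) = 1 := by
    ext a b
    simp [τ, genericProduct_apply, Matrix.one_apply, hri.eq_iff, hci.eq_iff]
  rw [h2, Matrix.det_one] at h1
  exact one_ne_zero h1

theorem det_submatrix_mem_span_genericMinors {s : ℕ} {ι : Type*} [Fintype ι] [DecidableEq ι]
    (hι : Fintype.card ι = s + 1) (ri : ι → Fin p) (ci : ι → Fin q) :
    ((Matrix.mvPolynomialX (Fin p) (Fin q) k).submatrix ri ci).det ∈
      Ideal.span (genericMinors k p q (s + 1)) := by
  rw [← Matrix.det_submatrix_equiv_self (Fintype.equivFinOfCardEq hι).symm,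
    Matrix.submatrix_submatrix, span_genericMinors_eq_rankIdeal]
  exact det_mem_rankIdeal (ρ := fun _ => s) (j := q) rfl _ _ fun b => Fin.is_lt _

/-- A minor of size `s + j` lies in the `j`-th symbolic power of the ideal of `(s + 1)`-minors. -/
theorem det_submatrix_mem_symbolicPower {s j : ℕ} {ri : Fin (s + j) → Fin p}
    {ci : Fin (s + j) → Fin q} (hri : Function.Injective ri) (hci : Function.Injective ci) :
    ((Matrix.mvPolynomialX (Fin p) (Fin q) k).submatrix ri ci).det ∈
      symbolicPower (Ideal.span (genericMinors k p q (s + 1))) j := by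
  have hI := isPrime_span_genericMinors k p q s
  set I := Ideal.span (genericMinors k p q (s + 1)) with hIdef
  set X := Matrix.mvPolynomialX (Fin p) (Fin q) k with hX
  set r : Fin s ⊕ Fin j → Fin p := ri ∘ finSumFinEquiv
  set c : Fin s ⊕ Fin j → Fin q := ci ∘ finSumFinEquiv
  have hdet : (X.submatrix ri ci).det = (X.submatrix r c).det := by
    rw [← Matrix.det_submatrix_equiv_self finSumFinEquiv, Matrix.submatrix_submatrix]
  set M := X.submatrix r c with hM
  have hA : M.toBlocks₁₁.det ∉ I := by
    rw [hIdef, span_genericMinors_eq_ker]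
    exact det_submatrix_notMem_ker (ri := r ∘ Sum.inl) (ci := c ∘ Sum.inl)
      ((hri.comp finSumFinEquiv.injective).comp Sum.inl_injective)
      ((hci.comp finSumFinEquiv.injective).comp Sum.inl_injective)
  set E := M.toBlocks₁₁.det • M.toBlocks₂₂ - M.toBlocks₂₁ * M.toBlocks₁₁.adjugate * M.toBlocks₁₂
    with hE
  have hEI : ∀ a b, E a b ∈ I := by
    intro a b
    have h1 := det_pow_card_mul_det_fromBlocks M.toBlocks₁₁
      (M.toBlocks₁₂.submatrix id fun _ : Unit => b) (M.toBlocks₂₁.submatrix (fun _ : Unit => a) id)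
      (M.toBlocks₂₂.submatrix (fun _ : Unit => a) fun _ : Unit => b)
    have h2 : Matrix.fromBlocks M.toBlocks₁₁
      (M.toBlocks₁₂.submatrix id fun _ : Unit => b) (M.toBlocks₂₁.submatrix (fun _ : Unit => a) id)
      (M.toBlocks₂₂.submatrix (fun _ : Unit => a) fun _ : Unit => b) =
      X.submatrix (r ∘ Sum.map id fun _ => a) (c ∘ Sum.map id fun _ => b) := by
      ext (x | x) (y | y) <;> rfl
    have h3 : (Matrix.det (M.toBlocks₁₁.det •
          M.toBlocks₂₂.submatrix (fun _ : Unit => a) (fun _ : Unit => b) -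
        M.toBlocks₂₁.submatrix (fun _ : Unit => a) id * M.toBlocks₁₁.adjugate *
          M.toBlocks₁₂.submatrix id fun _ : Unit => b)) = E a b := by
      rw [Matrix.det_unique]
      simp [hE, Matrix.mul_apply]
    rw [h2, h3] at h1
    refine (hI.mem_or_mem (h1 ▸ Ideal.mul_mem_left I _ ?_)).resolve_left hA
    exact det_submatrix_mem_span_genericMinors (by simp) _ _
  rw [hdet]
  refine mem_symbolicPower_iff.2 ⟨M.toBlocks₁₁.det ^ j, fun h => hA (hI.mem_of_pow_mem _ h), ?_⟩
  have h1 := det_pow_card_mul_det_fromBlocks M.toBlocks₁₁ M.toBlocks₁₂ M.toBlocks₂₁ M.toBlocks₂₂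
  rw [Matrix.fromBlocks_toBlocks, Fintype.card_fin] at h1
  rw [h1]
  simpa using Ideal.mul_mem_left _ _ (det_mem_pow_card hEI)

theorem exists_mem_symbolicPower {s a b : ℕ} (hpq : p ≤ q) (hs : s ≤ p) (hb : s + b ≤ p) :
    ∃ f ∈ symbolicPower (Ideal.span (genericMinors k p q (s + 1))) ((p - s) * a + b),
      f ≠ 0 ∧ f.IsHomogeneous (p * a + (s + b)) := by
  obtain ⟨r, rfl⟩ := Nat.exists_eq_add_of_le hs
  rw [Nat.add_sub_cancel_left]
  have hne : ∀ {u : ℕ} (h1 : u ≤ s + r) (h2 : u ≤ q),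
      ((Matrix.mvPolynomialX (Fin (s + r)) (Fin q) k).submatrix (Fin.castLE h1)
        (Fin.castLE h2)).det ≠ 0 := fun h1 h2 h0 =>
    det_submatrix_notMem_ker (k := k) (Fin.castLE_injective h1) (Fin.castLE_injective h2)
      (h0 ▸ zero_mem _)
  refine ⟨((Matrix.mvPolynomialX (Fin (s + r)) (Fin q) k).submatrix (Fin.castLE le_rfl)
      (Fin.castLE hpq)).det ^ a * ((Matrix.mvPolynomialX (Fin (s + r)) (Fin q) k).submatrix
      (Fin.castLE hb) (Fin.castLE (hb.trans hpq))).det, mul_mem_symbolicPower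
      (pow_mem_symbolicPower (det_submatrix_mem_symbolicPower (Fin.castLE_injective _)
        (Fin.castLE_injective _)) a)
      (det_submatrix_mem_symbolicPower (Fin.castLE_injective _) (Fin.castLE_injective _)),
      mul_ne_zero (pow_ne_zero _ (hne _ _)) (hne _ _), ?_⟩
  exact ((isHomogeneous_det_submatrix_mvPolynomialX _ _).pow a).mul
    (isHomogeneous_det_submatrix_mvPolynomialX _ _)

theorem exists_mem_symbolicPower_swap {t n d : ℕ} (ht : 1 ≤ t)
    (h : ∃ f ∈ symbolicPower (Ideal.span (genericMinors k p q t)) n, f ≠ 0 ∧ f.IsHomogeneous d) :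
    ∃ f ∈ symbolicPower (Ideal.span (genericMinors k q p t)) n, f ≠ 0 ∧ f.IsHomogeneous d := by
  obtain ⟨s, rfl⟩ := Nat.exists_eq_add_of_le' ht
  have hmap : ∀ {p q : ℕ} {g : MvPolynomial (Fin p × Fin q) k},
      g ∈ Ideal.span (genericMinors k p q (s + 1)) →
      MvPolynomial.rename Prod.swap g ∈ Ideal.span (genericMinors k q p (s + 1)) := by
    intro p q g hg
    have hle : Ideal.span (genericMinors k p q (s + 1)) ≤
        (Ideal.span (genericMinors k q p (s + 1))).comap
          (MvPolynomial.rename (R := k) (Prod.swap : Fin p × Fin q → _)) := by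
      rw [Ideal.span_le]
      rintro _ ⟨ri, ci, hri, hci, rfl⟩
      refine Ideal.subset_span ⟨ci, ri, hci, hri, ?_⟩
      rw [AlgHom.map_det, ← Matrix.det_transpose]
      congr 1
      ext a b
      simp
    exact hle hg
  have hp := isPrime_span_genericMinors k p q s
  have hq := isPrime_span_genericMinors k q p s
  obtain ⟨f, hf, hf0, hfd⟩ := h
  obtain ⟨c, hc, hcf⟩ := mem_symbolicPower_iff.1 hf
  refine ⟨MvPolynomial.rename Prod.swap f, mem_symbolicPower_iff.2
    ⟨MvPolynomial.rename Prod.swap c, fun h => hc ?_, ?_⟩, ?_, hfd.rename_isHomogeneous⟩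
  · simpa [MvPolynomial.rename_rename] using hmap h
  · rw [← map_mul]
    have hle : Ideal.span (genericMinors k p q (s + 1)) ^ n ≤
        (Ideal.span (genericMinors k q p (s + 1)) ^ n).comap
          (MvPolynomial.rename (R := k) (Prod.swap : Fin p × Fin q → _)) :=
      (Ideal.pow_right_mono (fun g hg => hmap hg) n).trans (Ideal.le_comap_pow _ _)
    exact hle hcf
  · exact (map_ne_zero_iff _ (MvPolynomial.rename_injective _ Prod.swap_injective)).2 hf0

theorem alphaDeg_symbolicPower_swap {t : ℕ} (ht : 1 ≤ t) (n : ℕ) :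
    alphaDeg (symbolicPower (Ideal.span (genericMinors k p q t)) n) =
      alphaDeg (symbolicPower (Ideal.span (genericMinors k q p t)) n) := by
  unfold alphaDeg
  congr 1
  ext d
  exact ⟨exists_mem_symbolicPower_swap ht, exists_mem_symbolicPower_swap ht⟩

theorem alphaDeg_symbolicPower_bounds {s n a b : ℕ} (hpq : p ≤ q) (hs : s < p) (hb : s + b ≤ p)
    (hn : n = (p - s) * a + b) :
    alphaDeg (symbolicPower (Ideal.span (genericMinors k p q (s + 1))) n) ≤ p * a + (s + b) ∧
    p * n + s * alphaDeg (symbolicPower (Ideal.span (genericMinors k p q (s + 1))) n) ≤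
      p * alphaDeg (symbolicPower (Ideal.span (genericMinors k p q (s + 1))) n) := by
  subst hn
  have h := exists_mem_symbolicPower (k := k) (a := a) hpq hs.le hb
  obtain ⟨f, hf, hf0, hfd⟩ := Nat.sInf_mem (s := {d | ∃ f ∈ symbolicPower
    (Ideal.span (genericMinors k p q (s + 1))) ((p - s) * a + b), f ≠ 0 ∧ f.IsHomogeneous d})
    ⟨_, h⟩
  exact ⟨Nat.sInf_le h, mul_add_mul_le_of_mem_symbolicPower hs hf hf0 hfd⟩

theorem demailly_of_le {t h n m : ℕ} (hpq : p ≤ q) (ht : 1 ≤ t) (htp : t ≤ p)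
    (hh : h = (p - t + 1) * (q - t + 1)) (hn : 1 ≤ n) (hm : 1 ≤ m) :
    n * (alphaDeg (symbolicPower (Ideal.span (genericMinors k p q t)) m) + h - 1) ≤
      (m + h - 1) * alphaDeg (symbolicPower (Ideal.span (genericMinors k p q t)) n) := by
  obtain ⟨s, rfl⟩ := Nat.exists_eq_add_of_le' ht
  obtain ⟨r, rfl⟩ : ∃ r, p = s + (r + 1) := ⟨p - (s + 1), by omega⟩
  have hdm : ∀ n : ℕ, 1 ≤ n → n = (s + (r + 1) - s) * ((n - 1) / (r + 1)) +
      ((n - 1) % (r + 1) + 1) := fun n hn => by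
    rw [Nat.add_sub_cancel_left, ← add_assoc, Nat.div_add_mod]
    omega
  have hlt : ∀ n : ℕ, s + ((n - 1) % (r + 1) + 1) ≤ s + (r + 1) := fun n => by
    have := Nat.mod_lt (n - 1) (show 0 < r + 1 by omega)
    omega
  have h1 := (alphaDeg_symbolicPower_bounds (k := k) hpq (by omega) (hlt m) (hdm m hm)).1
  have h2 := (alphaDeg_symbolicPower_bounds (k := k) hpq (by omega) (hlt n) (hdm n hn)).2
  have hdm' := hdm m hm
  generalize alphaDeg (symbolicPower (Ideal.span (genericMinors k (s + (r + 1)) q (s + 1))) m) = x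
    at *
  generalize alphaDeg (symbolicPower (Ideal.span (genericMinors k (s + (r + 1)) q (s + 1))) n) = y
    at *
  generalize (m - 1) / (r + 1) = a at *
  generalize (m - 1) % (r + 1) = b at *
  rw [Nat.add_sub_cancel_left] at hdm'
  obtain ⟨H, rfl, hH⟩ : ∃ H, h = H + 1 ∧ r ≤ H := by
    have : r + 1 ≤ h := by
      rw [hh, show s + (r + 1) - (s + 1) + 1 = r + 1 by omega]
      exact Nat.le_mul_of_pos_right _ (Nat.succ_pos _)
    exact ⟨h - 1, by omega, by omega⟩
  clear hlt hdm hh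
  rw [← Nat.add_assoc, ← Nat.add_assoc, Nat.add_sub_cancel, Nat.add_sub_cancel]
  subst hdm'
  have h3 : (s + (r + 1)) * n ≤ (r + 1) * y := by linarith
  set M := (r + 1) * a + (b + 1) with hM
  have h4 : x ≤ M + s * (a + 1) := by linarith
  have h5 : (r + 1) * (a + 1) ≤ M + H := by linarith
  refine Nat.le_of_mul_le_mul_left (c := r + 1) ?_ (Nat.succ_pos r)
  calc (r + 1) * (n * (x + H)) ≤ (r + 1) * (n * (M + s * (a + 1) + H)) := by gcongr
    _ = n * ((r + 1) * (M + H) + s * ((r + 1) * (a + 1))) := by ring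
    _ ≤ n * ((r + 1) * (M + H) + s * (M + H)) := by gcongr
    _ = (M + H) * ((s + (r + 1)) * n) := by ring
    _ ≤ (M + H) * ((r + 1) * y) := by gcongr
    _ = (r + 1) * ((M + H) * y) := by ring

end UpperBound

/-- **Demailly-like bound for generic determinantal ideals.** Let `I = I_t(X)` be the ideal
of `t`-minors of a generic `p×q` matrix of indeterminates, of height `h = (p−t+1)(q−t+1)`.
Then for all `n, m ≥ 1`, `(m+h−1)·α(I^{(n)}) ≥ n·(α(I^{(m)}) + h − 1)`. -/
theorem stmt_13 {k : Type*} [Field k] (p q t : ℕ) (ht : 1 ≤ t) (htp : t ≤ p) (htq : t ≤ q)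
    (h : ℕ) (hh : h = (p - t + 1) * (q - t + 1)) :
    ∀ n m : ℕ, 1 ≤ n → 1 ≤ m →
      n * (alphaDeg (symbolicPower (Ideal.span (genericMinors k p q t)) m) + h - 1) ≤
        (m + h - 1) * alphaDeg (symbolicPower (Ideal.span (genericMinors k p q t)) n) := by
  intro n m hn hm
  rcases le_total p q with hpq | hpq
  · exact demailly_of_le hpq ht htp hh hn hm
  · rw [alphaDeg_symbolicPower_swap ht n, alphaDeg_symbolicPower_swap ht m]
    exact demailly_of_le hpq ht htq (by rw [hh, mul_comm]) hn hm
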